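/- arXiv:2302.14158 — 5 statements merged into one kernel-verified Lean document; each statement's English description precedes it below -/
import Mathlib

section
/- Let a and b be positive integers. Then ℝ ∩ ℚ(ζ_a) = ℝ ∩ ℚ(ζ_b) (as subfields of ℂ) if and only if one of the following holds: (a) a = b; (b) a = 2b and b is odd; (c) b = 2a and a is odd; (d) both a and b lie in the set {1, 2, 3, 4, 6}. -/
/-- The primitive `n`-th root of unity `ζ_n = exp(2πi/n)` in `ℂ`. -/
noncomputable def zetaC (n : ℕ) : ℂ := Complex.exp (2 * Real.pi * Complex.I / n)

/-- `ℚ(z)`: the smallest subfield of `ℂ` containing `z` (it automatically contains `ℚ`). -/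
noncomputable def Qadj (z : ℂ) : Subfield ℂ := Subfield.closure {z}

/-- `ℝ` regarded as a subfield of `ℂ`. -/
noncomputable def realSubfield : Subfield ℂ := Complex.ofRealHom.fieldRange

open Polynomial

/-- Distinct primitive `n`-th roots of unity are roots of the same rational polynomials. -/
lemma IsPrimitiveRoot.aeval_pow_eq_zero_of_coprime {n u : ℕ} {z : ℂ} (hz : IsPrimitiveRoot z n)
    (hn : 0 < n) (hu : u.Coprime n) {p : ℚ[X]} (hp : aeval z p = 0) : aeval (z ^ u) p = 0 := by
  have h := minpoly.dvd ℚ z hp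
  rw [← cyclotomic_eq_minpoly_rat hz hn,
    cyclotomic_eq_minpoly_rat (hz.pow_of_coprime u hu) hn] at h
  exact aeval_eq_zero_of_dvd_aeval_eq_zero h (minpoly.aeval ℚ _)

lemma mem_realSubfield_iff {z : ℂ} : z ∈ realSubfield ↔ z.im = 0 := by
  constructor
  · rintro ⟨x, rfl⟩
    exact Complex.ofReal_im x
  · intro h
    exact ⟨z.re, Complex.ext rfl h.symm⟩

lemma self_mem_Qadj (z : ℂ) : z ∈ Qadj z :=
  Subfield.subset_closure rfl

lemma Qadj_le_of_mem {z w : ℂ} (h : z ∈ Qadj w) : Qadj z ≤ Qadj w :=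
  Subfield.closure_le.2 (Set.singleton_subset_iff.2 h)

lemma exists_aeval_eq_of_mem_Qadj {z w : ℂ} (hw : IsIntegral ℚ w) (hz : z ∈ Qadj w) :
    ∃ q : ℚ[X], aeval w q = z := by
  have hle : Qadj w ≤ (IntermediateField.adjoin ℚ {w}).toSubfield :=
    Subfield.closure_le.2 (IntermediateField.subset_adjoin ℚ {w})
  have hmem : z ∈ (IntermediateField.adjoin ℚ {w}).toSubalgebra := hle hz
  rw [IntermediateField.adjoin_simple_toSubalgebra_of_isAlgebraic hw.isAlgebraic,
    Algebra.adjoin_singleton_eq_range_aeval] at hmem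
  exact hmem

lemma isPrimitiveRoot_zetaC {n : ℕ} (hn : 0 < n) : IsPrimitiveRoot (zetaC n) n :=
  Complex.isPrimitiveRoot_exp n hn.ne'

lemma zetaC_mul_pow {m n : ℕ} (hm : 0 < m) : zetaC (m * n) ^ m = zetaC n := by
  have : (m : ℂ) ≠ 0 := by exact_mod_cast hm.ne'
  rw [zetaC, zetaC, ← Complex.exp_nat_mul]
  congr 1
  push_cast
  rw [← mul_div_assoc, mul_div_mul_left _ _ this]

lemma isIntegral_zetaC {n : ℕ} (hn : 0 < n) : IsIntegral ℚ (zetaC n) :=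
  ((isPrimitiveRoot_zetaC hn).isIntegral hn).tower_top

lemma zetaC_add_inv_mem_realSubfield {n : ℕ} (hn : 0 < n) :
    zetaC n + (zetaC n)⁻¹ ∈ realSubfield := by
  have hnorm : ‖zetaC n‖ = 1 := (isPrimitiveRoot_zetaC hn).norm'_eq_one hn.ne'
  rw [Complex.inv_eq_conj hnorm, Complex.add_conj]
  exact ⟨_, rfl⟩

lemma modEq_one_or_dvd_succ_of_zetaC_add_inv_mem {a b u : ℕ} (ha : 0 < a) (hb : 0 < b)
    (h : zetaC a + (zetaC a)⁻¹ ∈ Qadj (zetaC b)) (hua : u.Coprime a) (hub : u ≡ 1 [MOD b]) :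
    u ≡ 1 [MOD a] ∨ a ∣ u + 1 := by
  obtain ⟨q, hq⟩ := exists_aeval_eq_of_mem_Qadj (isIntegral_zetaC hb) h
  have hab : 0 < a * b := Nat.mul_pos ha hb
  have hz := isPrimitiveRoot_zetaC hab
  have hza := isPrimitiveRoot_zetaC ha
  have hzb := isPrimitiveRoot_zetaC hb
  have hza0 : zetaC a ≠ 0 := hza.ne_zero ha.ne'
  have hu : u.Coprime (a * b) := by
    refine hua.mul_right ?_
    have := hub.gcd_eq
    simpa [Nat.Coprime] using this
  have hinv : zetaC a ^ (a - 1) = (zetaC a)⁻¹ := by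
    refine eq_inv_of_mul_eq_one_left ?_
    rw [← pow_succ, Nat.sub_add_cancel ha, hza.pow_eq_one]
  have hpa : zetaC (a * b) ^ b = zetaC a := by rw [mul_comm, zetaC_mul_pow hb]
  have hpb : zetaC (a * b) ^ a = zetaC b := zetaC_mul_pow ha
  have hpub : zetaC b ^ u = zetaC b := by
    rw [pow_eq_pow_of_modEq hub hzb.pow_eq_one, pow_one]
  have key := hz.aeval_pow_eq_zero_of_coprime hab hu
    (p := X ^ b + (X ^ b) ^ (a - 1) - q.comp (X ^ a))
    (by simp [aeval_comp, hpa, hpb, hinv, hq])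
  simp only [map_sub, map_add, map_pow, aeval_X, aeval_comp, pow_right_comm _ u, hpa, hpb,
    hpub, hinv, hq] at key
  have hfac : (zetaC a ^ u - zetaC a) * (zetaC a ^ (u + 1) - 1) = 0 := by
    have hu0 : zetaC a ^ u ≠ 0 := pow_ne_zero u hza0
    rw [inv_pow] at key
    field_simp at key
    linear_combination key
  rcases mul_eq_zero.1 hfac with h | h
  · left
    have := (hza.isOfFinOrder ha.ne').pow_eq_pow_iff_modEq (n := u) (m := 1)
    rw [← hza.eq_orderOf] at this
    exact this.1 (by simpa using sub_eq_zero.1 h)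
  · exact Or.inr (hza.dvd_of_pow_eq_one _ (sub_eq_zero.1 h))

lemma mem_of_forall_coprime_modEq_one_or_dvd_succ {a : ℕ} (ha : 0 < a)
    (h : ∀ x : ℕ, x.Coprime a → (Even a → Odd x) → x ≡ 1 [MOD a] ∨ a ∣ x + 1) :
    a ∈ ({1, 2, 3, 4, 6} : Set ℕ) := by
  have hmod {x : ℕ} (hx : 1 ≤ x) : x ≡ 1 [MOD a] → a ∣ x - 1 :=
    fun hxa ↦ (Nat.modEq_iff_dvd' hx).1 hxa.symm
  simp only [Set.mem_insert_iff, Set.mem_singleton_iff]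
  rcases Nat.even_or_odd' a with ⟨m, rfl | rfl⟩
  · rcases Nat.even_or_odd m with hm | hm
    · have hcop : (m + 1).Coprime (2 * m) :=
        Nat.Coprime.mul_right (Nat.coprime_two_right.2 hm.add_one) (by simp)
      rcases h (m + 1) hcop fun _ ↦ hm.add_one with h | h
      · have := Nat.le_of_dvd (by lia) (hmod (by lia) h)
        lia
      · have := Nat.le_of_dvd (by lia) h
        lia
    · have hodd : Odd (m + 2) := hm.add_even even_two
      have hcop : (m + 2).Coprime (2 * m) :=
        Nat.Coprime.mul_right (Nat.coprime_two_right.2 hodd)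
          (by simpa using Nat.coprime_two_left.2 hm)
      rcases h (m + 2) hcop fun _ ↦ hodd with h | h
      · have := Nat.le_of_dvd (by lia) (hmod (by lia) h)
        lia
      · have := Nat.le_of_dvd (by lia) h
        grind
  · have hodd : Odd (2 * m + 1) := odd_two_mul_add_one m
    rcases h 2 (Nat.coprime_two_left.2 hodd)
      fun he ↦ absurd he (Nat.not_even_iff_odd.2 hodd) with h | h
    · have := Nat.le_of_dvd (by lia) (hmod (by lia) h)
      lia
    · have := Nat.le_of_dvd (by lia) h
      lia

lemma eq_or_of_forall_coprime_modEq_one {a g : ℕ} (ha : 0 < a) (hg : g ∣ a)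
    (h : ∀ x : ℕ, x.Coprime a → x ≡ 1 [MOD g] → x ≡ 1 [MOD a] ∨ a ∣ x + 1) :
    a = g ∨ (a = 2 * g ∧ Odd g) ∨ (g ∣ 2 ∧ a ∈ ({1, 2, 3, 4, 6} : Set ℕ)) := by
  by_cases hg2 : g ∣ 2
  · refine Or.inr (Or.inr ⟨hg2, mem_of_forall_coprime_modEq_one_or_dvd_succ ha
      fun x hx hodd ↦ h x hx ?_⟩)
    rcases (Nat.dvd_prime Nat.prime_two).1 hg2 with rfl | rfl
    · exact Nat.modEq_one
    · exact Nat.odd_iff.1 (hodd (even_iff_two_dvd.2 hg))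
  · have : NeZero a := ⟨ha.ne'⟩
    have : NeZero g := ⟨(Nat.pos_of_dvd_of_pos hg ha).ne'⟩
    have hinj : Function.Injective (ZMod.unitsMap hg) := by
      refine (injective_iff_map_eq_one _).2 fun u hu ↦ ?_
      have hval : (((u : ZMod a).val : ℕ) : ZMod a) = u := ZMod.natCast_zmod_val _
      have hug : (u : ZMod a).val ≡ 1 [MOD g] := by
        rw [← ZMod.natCast_eq_natCast_iff, ← ZMod.cast_eq_val, Nat.cast_one]
        exact congrArg Units.val hu
      rcases h _ (ZMod.val_coe_unit_coprime u) hug with h | h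
      · rw [← ZMod.natCast_eq_natCast_iff, hval] at h
        exact Units.ext (by simpa using h)
      · exact absurd (((hug.add_right 1).dvd_iff dvd_rfl).1 (hg.trans h)) hg2
    have hcard := Nat.card_congr
      (Equiv.ofBijective _ ⟨hinj, ZMod.unitsMap_surjective hg⟩)
    rw [Nat.card_eq_fintype_card, Nat.card_eq_fintype_card, ZMod.card_units_eq_totient,
      ZMod.card_units_eq_totient] at hcard
    rcases Nat.even_or_odd g with he | ho
    · exact Or.inl (he.eq_of_totient_eq_totient hg hcard.symm).symm
    · rcases Nat.eq_or_eq_of_totient_eq_totient hg hcard.symm with h | h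
      · exact Or.inl h.symm
      · exact Or.inr (Or.inl ⟨h.symm, ho⟩)

lemma zetaC_two_mul_of_odd {n : ℕ} (hn : Odd n) : Qadj (zetaC (2 * n)) = Qadj (zetaC n) := by
  have hpos : 0 < n := hn.pos
  have hsq : zetaC (2 * n) ^ 2 = zetaC n := zetaC_mul_pow two_pos
  apply le_antisymm
  · refine Qadj_le_of_mem ?_
    obtain ⟨k, rfl⟩ := hn
    have hneg : zetaC (2 * (2 * k + 1)) ^ (2 * k + 1) = -1 := by
      rw [mul_comm, zetaC_mul_pow hpos]
      exact (isPrimitiveRoot_zetaC two_pos).eq_neg_one_of_two_right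
    have : zetaC (2 * (2 * k + 1)) = -zetaC (2 * k + 1) ^ (k + 1) := by
      rw [← hsq]
      linear_combination zetaC (2 * (2 * k + 1)) * hneg
    rw [this]
    exact neg_mem (pow_mem (self_mem_Qadj _) _)
  · exact Qadj_le_of_mem (hsq ▸ pow_mem (self_mem_Qadj _) 2)

/-- An imaginary quadratic field has no real elements besides the rationals. -/
lemma realSubfield_inf_Qadj_eq_bot_of_sq {z : ℂ} (hz : z.im ≠ 0) {s t : ℚ}
    (h : z ^ 2 = s * z + t) : realSubfield ⊓ Qadj z = ⊥ := by
  have hint : IsIntegral ℚ z := by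
    refine ⟨X ^ 2 - (C s * X + C t), ?_, ?_⟩
    · monicity!
    · simp [h]
  have hlin : ∀ p : ℚ[X], ∃ x y : ℚ, aeval z p = x + y * z := by
    intro p
    induction p using Polynomial.induction_on with
    | C r => exact ⟨r, 0, by simp⟩
    | add p q hp hq =>
      obtain ⟨x, y, hp⟩ := hp
      obtain ⟨x', y', hq⟩ := hq
      exact ⟨x + x', y + y', by rw [map_add, hp, hq]; push_cast; ring⟩
    | monomial n r ih =>
      obtain ⟨x, y, ih⟩ := ih
      refine ⟨y * t, x + y * s, ?_⟩
      rw [pow_succ, ← mul_assoc, map_mul, ih, aeval_X]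
      push_cast
      linear_combination (y : ℂ) * h
  refine le_bot_iff.1 fun w hw ↦ ?_
  obtain ⟨hre, hw⟩ := Subfield.mem_inf.1 hw
  obtain ⟨q, rfl⟩ := exists_aeval_eq_of_mem_Qadj hint hw
  obtain ⟨x, y, hq⟩ := hlin q
  rw [mem_realSubfield_iff, hq] at hre
  have hy : y = 0 := by simpa [hz] using hre
  rw [hq, hy, Rat.cast_zero, zero_mul, add_zero]
  exact SubfieldClass.ratCast_mem _ x

lemma realSubfield_inf_Qadj_zetaC_eq_bot {n : ℕ} (hn : n ∈ ({1, 2, 3, 4, 6} : Set ℕ)) :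
    realSubfield ⊓ Qadj (zetaC n) = ⊥ := by
  have h1 : realSubfield ⊓ Qadj (zetaC 1) = ⊥ := by
    refine le_bot_iff.1 (inf_le_right.trans (Subfield.closure_le.2 ?_))
    rw [Set.singleton_subset_iff, IsPrimitiveRoot.one_right_iff.1 (isPrimitiveRoot_zetaC one_pos)]
    exact one_mem _
  have h3 : realSubfield ⊓ Qadj (zetaC 3) = ⊥ := by
    have hsq : zetaC 3 ^ 2 = -zetaC 3 - 1 := by
      have := (isPrimitiveRoot_zetaC (n := 3) (by norm_num)).geom_sum_eq_zero (by norm_num)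
      simp only [Finset.sum_range_succ, Finset.sum_range_zero] at this
      linear_combination this
    refine realSubfield_inf_Qadj_eq_bot_of_sq (s := -1) (t := -1) (fun him ↦ ?_) ?_
    · have := congrArg Complex.re hsq
      simp [pow_two, him] at this
      nlinarith [sq_nonneg ((zetaC 3).re + 1 / 2)]
    · rw [hsq]; push_cast; ring
  have h4 : realSubfield ⊓ Qadj (zetaC 4) = ⊥ := by
    have hsq : zetaC 4 ^ 2 = -1 := by
      rw [show 4 = 2 * 2 from rfl, zetaC_mul_pow two_pos]
      exact (isPrimitiveRoot_zetaC two_pos).eq_neg_one_of_two_right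
    refine realSubfield_inf_Qadj_eq_bot_of_sq (s := 0) (t := -1) (fun him ↦ ?_) ?_
    · have := congrArg Complex.re hsq
      rw [pow_two, Complex.mul_re, him] at this
      norm_num at this
      nlinarith [mul_self_nonneg (zetaC 4).re]
    · rw [hsq]; push_cast; ring
  rcases hn with rfl | rfl | rfl | rfl | rfl
  · exact h1
  · rw [show 2 = 2 * 1 from rfl, zetaC_two_mul_of_odd odd_one, h1]
  · exact h3
  · exact h4
  · rw [show 6 = 2 * 3 from rfl, zetaC_two_mul_of_odd (by decide), h3]

lemma eq_or_of_zetaC_add_inv_mem {a b : ℕ} (ha : 0 < a) (hb : 0 < b)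
    (h : zetaC a + (zetaC a)⁻¹ ∈ Qadj (zetaC b)) :
    a = a.gcd b ∨ (a = 2 * a.gcd b ∧ Odd (a.gcd b)) ∨
      (a.gcd b ∣ 2 ∧ a ∈ ({1, 2, 3, 4, 6} : Set ℕ)) := by
  refine eq_or_of_forall_coprime_modEq_one ha (Nat.gcd_dvd_left a b) fun x hx hxg ↦ ?_
  obtain ⟨u, hua, hub⟩ := Nat.chineseRemainder' hxg
  have hu : u.Coprime a := by rw [Nat.Coprime, hua.gcd_eq]; exact hx
  refine (modEq_one_or_dvd_succ_of_zetaC_add_inv_mem ha hb h hu hub).imp hua.symm.trans fun hd ↦ ?_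
  exact ((hua.add_right 1).dvd_iff dvd_rfl).1 hd

/-- Lemma `lma:real-cyclotomic`: for positive integers `a, b`,
`ℝ ∩ ℚ(ζ_a) = ℝ ∩ ℚ(ζ_b)` iff `a = b`, or `a = 2b` with `b` odd, or `b = 2a` with `a` odd,
or both `a` and `b` lie in `{1, 2, 3, 4, 6}`. -/
theorem real_inter_cyclotomic_eq_iff (a b : ℕ) (ha : 0 < a) (hb : 0 < b) :
    realSubfield ⊓ Qadj (zetaC a) = realSubfield ⊓ Qadj (zetaC b) ↔
      a = b ∨ (a = 2 * b ∧ Odd b) ∨ (b = 2 * a ∧ Odd a) ∨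
        (a ∈ ({1, 2, 3, 4, 6} : Set ℕ) ∧ b ∈ ({1, 2, 3, 4, 6} : Set ℕ)) := by
  constructor
  · intro h
    have hmem {n : ℕ} (hn : 0 < n) :
        zetaC n + (zetaC n)⁻¹ ∈ realSubfield ⊓ Qadj (zetaC n) :=
      ⟨zetaC_add_inv_mem_realSubfield hn,
        add_mem (self_mem_Qadj _) ((Qadj _).inv_mem (self_mem_Qadj _))⟩
    have hA := eq_or_of_zetaC_add_inv_mem ha hb (h ▸ hmem ha).2
    have hB := eq_or_of_zetaC_add_inv_mem hb ha (h ▸ hmem hb).2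
    rw [Nat.gcd_comm b a] at hB
    generalize a.gcd b = g at hA hB
    simp only [Set.mem_insert_iff, Set.mem_singleton_iff, Nat.odd_iff,
      Nat.dvd_prime Nat.prime_two] at hA hB ⊢
    omega
  · rintro (rfl | ⟨rfl, hodd⟩ | ⟨rfl, hodd⟩ | ⟨hA, hB⟩)
    · rfl
    · rw [zetaC_two_mul_of_odd hodd]
    · rw [zetaC_two_mul_of_odd hodd]
    · rw [realSubfield_inf_Qadj_zetaC_eq_bot hA, realSubfield_inf_Qadj_zetaC_eq_bot hB]
end

section
/- Let r₁ and r₂ be two distinct rational numbers in the interval (0, 1/4]. Then the ratio sin(2πr₁)/sin(2πr₂) is rational if and only if (r₁, r₂) = (1/4, 1/12) or (r₁, r₂) = (1/12, 1/4). In particular, for all other pairs of distinct rationals in (0, 1/4], the ratio sin(2πr₁)/sin(2πr₂) is irrational. -/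
/-- A rational relation between cosines of rational angles is preserved by Galois conjugation. -/
lemma cos_conj_of_nat {N A B k : ℕ} {s : ℚ} (hN : 0 < N) (hk : k.Coprime N)
    (h : Real.cos (2 * Real.pi * (A / N)) = s * Real.cos (2 * Real.pi * (B / N))) :
    Real.cos (2 * Real.pi * (k * (A / N))) = s * Real.cos (2 * Real.pi * (k * (B / N))) := by
  have hN' : (N : ℂ) ≠ 0 := by exact_mod_cast hN.ne'
  set ζ : ℂ := Complex.exp (2 * Real.pi * Complex.I / N) with hζ
  have hprim : IsPrimitiveRoot ζ N := Complex.isPrimitiveRoot_exp N hN.ne'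
  have key (j C : ℕ) : (ζ ^ j) ^ C + (ζ ^ j) ^ (C * (N - 1))
      = 2 * (Real.cos (2 * Real.pi * (j * (C / N))) : ℂ) := by
    have h1 : (ζ ^ j) ^ C = Complex.exp (2 * Real.pi * (j * (C / N)) * Complex.I) := by
      rw [hζ, ← Complex.exp_nat_mul, ← Complex.exp_nat_mul]
      congr 1
      field_simp
    have h2 : (ζ ^ j) ^ (C * (N - 1))
        = Complex.exp (-(2 * Real.pi * (j * (C / N))) * Complex.I) := by
      rw [neg_mul, Complex.exp_neg, ← h1]
      refine eq_inv_of_mul_eq_one_left ?_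
      rw [← pow_add, ← Nat.mul_add_one, Nat.sub_add_cancel hN, mul_comm C N, pow_mul, ← pow_mul ζ,
        mul_comm j N, pow_mul ζ, hprim.pow_eq_one, one_pow, one_pow]
    rw [h1, h2]
    push_cast
    rw [Complex.cos]
    ring
  set P : Polynomial ℚ := Polynomial.X ^ A + Polynomial.X ^ (A * (N - 1))
    - Polynomial.C s * (Polynomial.X ^ B + Polynomial.X ^ (B * (N - 1))) with hP
  have hPj (j : ℕ) : Polynomial.aeval (ζ ^ j) P
      = 2 * (Real.cos (2 * Real.pi * (j * (A / N))) : ℂ)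
        - s * (2 * (Real.cos (2 * Real.pi * (j * (B / N))) : ℂ)) := by
    rw [← key, ← key]
    simp [hP]
  have h0 : Polynomial.aeval ζ P = 0 := by
    have := hPj 1
    rw [pow_one] at this
    rw [this]
    simp only [Nat.cast_one, one_mul]
    rw [h]
    push_cast
    ring
  have hdvd : minpoly ℚ (ζ ^ k) ∣ P := by
    rw [← Polynomial.cyclotomic_eq_minpoly_rat (hprim.pow_of_coprime k hk) hN,
      Polynomial.cyclotomic_eq_minpoly_rat hprim hN]
    exact minpoly.dvd ℚ ζ h0
  have hk0 : Polynomial.aeval (ζ ^ k) P = 0 := by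
    obtain ⟨Q, hQ⟩ := hdvd
    rw [hQ, map_mul, minpoly.aeval, zero_mul]
  rw [hPj] at hk0
  have : ((Real.cos (2 * Real.pi * (k * (A / N))) : ℝ) : ℂ)
      = ((s * Real.cos (2 * Real.pi * (k * (B / N))) : ℝ) : ℂ) := by
    push_cast at hk0 ⊢
    linear_combination hk0 / 2
  exact_mod_cast this

lemma cos_conj {a b s : ℚ} {k : ℕ} (ha : 0 ≤ a) (hb : 0 ≤ b) (hk : k.Coprime (a.den * b.den))
    (h : Real.cos (2 * Real.pi * a) = s * Real.cos (2 * Real.pi * b)) :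
    Real.cos (2 * Real.pi * (k * a)) = s * Real.cos (2 * Real.pi * (k * b)) := by
  have hN : 0 < a.den * b.den := Nat.mul_pos a.den_pos b.den_pos
  have hnum {c : ℚ} (hc : 0 ≤ c) : (c.num.toNat : ℚ) = c.num := by
    exact_mod_cast Int.toNat_of_nonneg (Rat.num_nonneg.2 hc)
  have hda : (a.den : ℚ) ≠ 0 := by exact_mod_cast a.den_nz
  have hdb : (b.den : ℚ) ≠ 0 := by exact_mod_cast b.den_nz
  have hA : (a : ℝ) = ((a.num.toNat * b.den : ℕ) : ℝ) / ((a.den * b.den : ℕ) : ℝ) := by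
    have : a = ((a.num.toNat * b.den : ℕ) : ℚ) / ((a.den * b.den : ℕ) : ℚ) := by
      push_cast
      rw [hnum ha, mul_div_mul_right _ _ hdb, Rat.num_div_den]
    simpa only [Rat.cast_div, Rat.cast_natCast] using congrArg (Rat.cast : ℚ → ℝ) this
  have hB : (b : ℝ) = ((b.num.toNat * a.den : ℕ) : ℝ) / ((a.den * b.den : ℕ) : ℝ) := by
    have : b = ((b.num.toNat * a.den : ℕ) : ℚ) / ((a.den * b.den : ℕ) : ℚ) := by
      push_cast
      rw [hnum hb, mul_comm (a.den : ℚ), mul_div_mul_right _ _ hda, Rat.num_div_den]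
    simpa only [Rat.cast_div, Rat.cast_natCast] using congrArg (Rat.cast : ℚ → ℝ) this
  rw [hA, hB] at h ⊢
  exact cos_conj_of_nat hN hk h

lemma dvd_sub_or_dvd_add_of_cos_eq {b : ℚ} {k : ℕ}
    (h : Real.cos (2 * Real.pi * (k * b)) = Real.cos (2 * Real.pi * b)) :
    (b.den : ℤ) ∣ k - 1 ∨ (b.den : ℤ) ∣ k + 1 := by
  have hcop : IsCoprime (b.den : ℤ) b.num :=
    b.isCoprime_num_den.symm
  have hd : (b.den : ℚ) ≠ 0 := by exact_mod_cast b.den_nz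
  have hπ := Real.pi_ne_zero
  have of_int {t j : ℤ} (e : (t : ℚ) * b = j) : (b.den : ℤ) ∣ t := by
    refine hcop.dvd_of_dvd_mul_right ⟨j, ?_⟩
    nth_rw 1 [← Rat.num_div_den b] at e
    field_simp at e
    exact_mod_cast e
  obtain ⟨j, hj | hj⟩ := Real.cos_eq_cos_iff.1 h
  · left
    refine of_int (j := -j) ?_
    have : ((k : ℝ) - 1) * b = -j := by
      apply mul_left_cancel₀ (mul_ne_zero two_ne_zero hπ)
      linear_combination -hj
    exact_mod_cast this
  · right
    refine of_int (j := j) ?_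
    have : ((k : ℝ) + 1) * b = j := by
      apply mul_left_cancel₀ (mul_ne_zero two_ne_zero hπ)
      linear_combination hj
    exact_mod_cast this

lemma cos_two_pi_mul_of_modEq {a : ℚ} {k l : ℕ} (h : k ≡ l [MOD a.den]) :
    Real.cos (2 * Real.pi * (k * a)) = Real.cos (2 * Real.pi * (l * a)) := by
  obtain ⟨t, ht⟩ := h.dvd
  rw [Real.cos_eq_cos_iff]
  refine ⟨t * a.num, Or.inl ?_⟩
  have h1 : (l : ℝ) - k = a.den * t := by exact_mod_cast ht
  have h2 : (a : ℝ) * a.den = a.num := by exact_mod_cast Rat.mul_den_eq_num a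
  push_cast
  linear_combination 2 * Real.pi * a * h1 + 2 * Real.pi * t * h2

lemma le_six_of_coprime_dvd {n : ℕ} (hn : 0 < n)
    (H : ∀ k : ℕ, k.Coprime n → (n : ℤ) ∣ k - 1 ∨ (n : ℤ) ∣ k + 1) : n ≤ 6 ∧ n ≠ 5 := by
  have key (k : ℕ) (hk : k.Coprime n) (h1 : 2 ≤ k) : n ≤ k + 1 := by
    rcases H k hk with h | h <;>
    · have := Int.le_of_dvd (by omega) h
      omega
  rcases Nat.even_or_odd' n with ⟨t, rfl | rfl⟩
  · rcases Nat.even_or_odd' t with ⟨u, rfl | rfl⟩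
    · have := key (2 * u + 1) (by
        have h1 : (2 * u + 1).Coprime (2 * u) := by simp
        have h2 : (2 * u + 1).Coprime 2 := by simp
        exact h2.mul_right h1) (by omega)
      omega
    · have := key (2 * u + 3) (by
        have h2 : (2 * u + 3).Coprime 2 := by simp [Nat.coprime_two_right, parity_simps]
        have h1 : (2 * u + 3).Coprime (2 * u + 1) := by
          rw [show 2 * u + 3 = 2 + (2 * u + 1) by ring]
          simp
        exact h2.mul_right h1) (by omega)
      omega
  · by_cases ht : t = 0
    · omega
    · have := key 2 (by simp) le_rfl
      omega

lemma coprime_dvd_of_gcd {m n : ℕ}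
    (H : ∀ k : ℕ, k.Coprime (m * n) → k ≡ 1 [MOD m] → (n : ℤ) ∣ k - 1 ∨ (n : ℤ) ∣ k + 1)
    {k : ℕ} (hk : k.Coprime n) (h1 : k ≡ 1 [MOD m.gcd n]) :
    (n : ℤ) ∣ k - 1 ∨ (n : ℤ) ∣ k + 1 := by
  obtain ⟨K, hKm, hKn⟩ := Nat.chineseRemainder' h1.symm
  have h : K.Coprime (m * n) :=
    Nat.Coprime.mul_right (by rw [Nat.Coprime, hKm.gcd_eq]; simp)
      (by rw [Nat.Coprime, hKn.gcd_eq]; exact hk)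
  have hKn' := (Int.modEq_iff_dvd.1 (Int.natCast_modEq_iff.2 hKn))
  refine (H K h hKm).imp (fun h ↦ ?_) (fun h ↦ ?_)
  · have := dvd_add h hKn'
    ring_nf at this ⊢
    exact this
  · have := dvd_add h hKn'
    ring_nf at this ⊢
    exact this

/-- If `3 ≤ d ∣ n` and every unit modulo `n` that is `1` modulo `d` is `1` or `-1`, then
`n` and `d` have the same totient. -/
lemma eq_or_two_mul_eq_of_coprime_dvd {d n : ℕ} (hn : 0 < n) (hdn : d ∣ n) (hd : 3 ≤ d)
    (H : ∀ k : ℕ, k.Coprime n → k ≡ 1 [MOD d] → (n : ℤ) ∣ k - 1 ∨ (n : ℤ) ∣ k + 1) :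
    n = d ∨ n = 2 * d ∧ Odd d := by
  have : NeZero n := ⟨hn.ne'⟩
  have : NeZero d := ⟨by omega⟩
  have hinj : Function.Injective (ZMod.unitsMap hdn) := by
    rw [injective_iff_map_eq_one]
    intro u hu
    have hk := ZMod.val_coe_unit_coprime u
    have hmod : (u : ZMod n).val ≡ 1 [MOD d] := by
      rw [← ZMod.natCast_eq_natCast_iff, ZMod.natCast_val, ← ZMod.unitsMap_val hdn, hu]
      simp
    have hval : (((u : ZMod n).val : ℤ) : ZMod n) = u := by simp
    rcases H _ hk hmod with h | h
    · rw [← ZMod.intCast_zmod_eq_zero_iff_dvd] at h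
      push_cast at h
      ext
      simpa [sub_eq_zero] using h
    · have h1 : (d : ℤ) ∣ 1 - (u : ZMod n).val := by
        simpa using Int.modEq_iff_dvd.1 (Int.natCast_modEq_iff.2 hmod)
      have h2 := dvd_add h1 ((Int.natCast_dvd_natCast.2 hdn).trans h)
      have := Int.le_of_dvd (by omega) h2
      omega
  have hle := Fintype.card_le_of_injective _ hinj
  rw [ZMod.card_units_eq_totient, ZMod.card_units_eq_totient] at hle
  have heq : d.totient = n.totient :=
    le_antisymm (Nat.le_of_dvd (Nat.totient_pos.2 hn) (Nat.totient_dvd_of_dvd hdn)) hle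
  rcases Nat.even_or_odd d with he | ho
  · exact Or.inl (he.eq_of_totient_eq_totient hdn heq).symm
  · exact (Nat.eq_or_eq_of_totient_eq_totient hdn heq).imp Eq.symm fun h ↦ ⟨h.symm, ho⟩

lemma exists_coprime_dvd_sub {q N : ℕ} {A B : ℤ} (hN : 0 < N) (hq : q ∣ N)
    (hA : IsCoprime A q) (hB : IsCoprime B q) :
    ∃ k : ℕ, k.Coprime N ∧ (q : ℤ) ∣ B - k * A := by
  have : NeZero N := ⟨hN.ne'⟩
  obtain ⟨u, hu⟩ := ZMod.unitsMap_surjective hq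
    (ZMod.unitOfIsCoprime B hB * (ZMod.unitOfIsCoprime A hA)⁻¹)
  refine ⟨(u : ZMod N).val, ZMod.val_coe_unit_coprime u, ?_⟩
  rw [← ZMod.intCast_zmod_eq_zero_iff_dvd]
  have h := congrArg (Units.val : (ZMod q)ˣ → ZMod q) (eq_mul_inv_iff_mul_eq.1 hu)
  rw [Units.val_mul, ZMod.unitsMap_val, ZMod.coe_unitOfIsCoprime, ZMod.coe_unitOfIsCoprime] at h
  push_cast
  rw [ZMod.natCast_val, h, sub_self]

lemma cos_two_pi_mul_pos {a : ℚ} (ha : 0 ≤ a) (ha' : a < 1 / 4) :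
    0 < Real.cos (2 * Real.pi * a) := by
  have h0 : (0 : ℝ) ≤ a := by exact_mod_cast ha
  have h1 : (a : ℝ) < 1 / 4 := by simpa using (Rat.cast_lt (K := ℝ)).2 ha'
  have := Real.pi_pos
  exact Real.cos_pos_of_mem_Ioo ⟨by nlinarith, by nlinarith⟩

/-- Cosines related by a Galois conjugation, up to sign, have no rational ratio besides `1`. -/
lemma eq_of_cos_ratio_of_conj {a b s : ℚ} {k : ℕ} {j : ℤ} (ha : 0 ≤ a) (ha' : a < 1 / 4)
    (hb : 0 ≤ b) (hb' : b < 1 / 4) (hk : k.Coprime (a.den * b.den)) (hj : 2 * b - 2 * (k * a) = j)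
    (h : Real.cos (2 * Real.pi * a) = s * Real.cos (2 * Real.pi * b)) : a = b := by
  have hpa := cos_two_pi_mul_pos ha ha'
  have hpb := cos_two_pi_mul_pos hb hb'
  have hs : (0 : ℝ) < s := pos_of_mul_pos_left (h ▸ hpa) hpb.le
  have hconj (i : ℕ) : |Real.cos (2 * Real.pi * (i * b))|
      = |Real.cos (2 * Real.pi * ((i * k : ℕ) * a))| := by
    have hj' : (2 : ℝ) * b - 2 * (k * a) = j := by exact_mod_cast hj
    have : 2 * Real.pi * (i * b) = 2 * Real.pi * ((i * k : ℕ) * a) + ((i * j : ℤ) : ℝ) * Real.pi := by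
      push_cast
      linear_combination Real.pi * i * hj'
    rw [this, Real.cos_add_int_mul_pi, abs_mul, abs_zpow]
    simp
  have hiter (i : ℕ) : |Real.cos (2 * Real.pi * a)|
      = (s : ℝ) ^ i * |Real.cos (2 * Real.pi * ((k ^ i : ℕ) * a))| := by
    induction i with
    | zero => simp
    | succ i ih =>
      rw [ih, cos_conj ha hb (hk.pow_left i) h, abs_mul, abs_of_pos hs, hconj, pow_succ, pow_succ]
      ring
  have hN : 0 < a.den * b.den := Nat.mul_pos a.den_pos b.den_pos
  have hone := hiter (a.den * b.den).totient
  rw [cos_two_pi_mul_of_modEq ((Nat.ModEq.pow_totient hk).of_mul_right b.den)] at hone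
  simp only [Nat.cast_one, one_mul] at hone
  have hs1 : (s : ℝ) = 1 := by
    rw [← pow_eq_one_iff_of_nonneg hs.le (Nat.totient_pos.2 hN).ne']
    exact mul_right_cancel₀ (abs_pos.2 hpa.ne').ne' (by rw [one_mul]; exact hone.symm)
  rw [hs1, one_mul] at h
  have hmem {c : ℚ} (hc : 0 ≤ c) (hc' : c < 1 / 4) :
      2 * Real.pi * (c : ℝ) ∈ Set.Icc 0 Real.pi := by
    have h0 : (0 : ℝ) ≤ c := by exact_mod_cast hc
    have h1 : (c : ℝ) < 1 / 4 := by simpa using (Rat.cast_lt (K := ℝ)).2 hc'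
    have := Real.pi_pos
    exact ⟨by positivity, by nlinarith⟩
  have := mul_left_cancel₀ (mul_ne_zero two_ne_zero Real.pi_ne_zero)
    (Real.injOn_cos (hmem ha ha') (hmem hb hb') h)
  exact_mod_cast this

lemma eq_zero_or_eq_sixth_of_den_le {a : ℚ} (ha : 0 ≤ a) (ha' : a < 1 / 4) (hd : a.den ≤ 6)
    (hd5 : a.den ≠ 5) : a = 0 ∨ a = 1 / 6 := by
  have hpos := a.den_pos
  have hq := Rat.num_div_den a
  have h0 := Rat.num_nonneg.2 ha
  have hdq : (0 : ℚ) < a.den := by exact_mod_cast hpos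
  have h4 : 4 * a.num < a.den := by
    rw [← hq, div_lt_div_iff₀ hdq (by norm_num)] at ha'
    have : a.num * 4 < 1 * (a.den : ℤ) := by exact_mod_cast ha'
    omega
  rcases h0.eq_or_lt with h | h
  · left
    exact Rat.num_eq_zero.1 h.symm
  · right
    have h6 : a.den = 6 := by omega
    have h1 : a.num = 1 := by omega
    rw [← hq, h6, h1]
    norm_num

lemma cos_ratio_cases {a b s : ℚ} (ha : 0 ≤ a) (ha' : a < 1 / 4) (hb : 0 ≤ b) (hb' : b < 1 / 4)
    (hne : a ≠ b) (h : Real.cos (2 * Real.pi * a) = s * Real.cos (2 * Real.pi * b)) :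
    (a = 0 ∧ b = 1 / 6) ∨ (a = 1 / 6 ∧ b = 0) := by
  have hpa := cos_two_pi_mul_pos ha ha'
  have hs : (s : ℝ) ≠ 0 := by
    rintro hs
    simp [hs] at h
    exact hpa.ne' h
  have Hb (k : ℕ) (hk : k.Coprime (a.den * b.den)) (h1 : k ≡ 1 [MOD a.den]) :
      (b.den : ℤ) ∣ k - 1 ∨ (b.den : ℤ) ∣ k + 1 := by
    refine dvd_sub_or_dvd_add_of_cos_eq (mul_left_cancel₀ hs ?_)
    rw [← h, ← cos_conj ha hb hk h, cos_two_pi_mul_of_modEq h1]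
    simp
  have Ha (k : ℕ) (hk : k.Coprime (b.den * a.den)) (h1 : k ≡ 1 [MOD b.den]) :
      (a.den : ℤ) ∣ k - 1 ∨ (a.den : ℤ) ∣ k + 1 := by
    refine dvd_sub_or_dvd_add_of_cos_eq ?_
    rw [cos_conj ha hb (mul_comm b.den a.den ▸ hk) h, cos_two_pi_mul_of_modEq h1, h]
    simp
  have hmpos := a.den_pos
  have hnpos := b.den_pos
  have hN : 0 < a.den * b.den := Nat.mul_pos hmpos hnpos
  by_cases hd : a.den.gcd b.den ≤ 2
  · have hmod {k n : ℕ} (hdvd : a.den.gcd b.den ∣ n) (hk : k.Coprime n) :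
        k ≡ 1 [MOD a.den.gcd b.den] := by
      have hk' := hk.coprime_dvd_right hdvd
      have hpos := Nat.gcd_pos_of_pos_left b.den hmpos
      generalize a.den.gcd b.den = d at hd hk' hpos
      interval_cases d
      · exact Nat.modEq_one
      · exact Nat.odd_iff.1 (Nat.coprime_two_right.1 hk')
    have hb6 := le_six_of_coprime_dvd hnpos fun k hk ↦
      coprime_dvd_of_gcd Hb hk (hmod (Nat.gcd_dvd_right _ _) hk)
    have ha6 := le_six_of_coprime_dvd hmpos fun k hk ↦
      coprime_dvd_of_gcd Ha hk (Nat.gcd_comm a.den b.den ▸ hmod (Nat.gcd_dvd_left _ _) hk)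
    rcases eq_zero_or_eq_sixth_of_den_le ha ha' ha6.1 ha6.2 with h1 | h1 <;>
    rcases eq_zero_or_eq_sixth_of_den_le hb hb' hb6.1 hb6.2 with h2 | h2 <;>
    simp_all
  · exfalso
    have hnd := eq_or_two_mul_eq_of_coprime_dvd hnpos (Nat.gcd_dvd_right a.den b.den) (by omega)
      fun k hk ↦ coprime_dvd_of_gcd Hb hk
    have hmd := eq_or_two_mul_eq_of_coprime_dvd hmpos (Nat.gcd_dvd_left a.den b.den) (by omega)
      fun k hk h1 ↦ coprime_dvd_of_gcd Ha hk (Nat.gcd_comm a.den b.den ▸ h1)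
    have hda : (a.den : ℚ) ≠ 0 := by exact_mod_cast hmpos.ne'
    have hdb : (b.den : ℚ) ≠ 0 := by exact_mod_cast hnpos.ne'
    have hma := Rat.mul_den_eq_num a
    have hmb := Rat.mul_den_eq_num b
    have h2 {c : ℚ} {d : ℕ} (ho : Odd d) (hc : IsCoprime c.num d) : IsCoprime (2 * c.num) d :=
      .mul_left (by exact_mod_cast Nat.isCoprime_iff_coprime.2 (Nat.coprime_two_left.2 ho)) hc
    suffices ∃ (k : ℕ) (j : ℤ), k.Coprime (a.den * b.den) ∧ 2 * b - 2 * (k * a) = j by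
      obtain ⟨k, j, hk, hj⟩ := this
      exact hne (eq_of_cos_ratio_of_conj ha ha' hb hb' hk hj h)
    have hcases : a.den = b.den ∨ b.den = 2 * a.den ∧ Odd a.den ∨
        a.den = 2 * b.den ∧ Odd b.den := by
      rcases hmd with hm | ⟨hm, ho⟩ <;> rcases hnd with hn | ⟨hn, ho'⟩
      · exact Or.inl (hm.trans hn.symm)
      · exact Or.inr (Or.inl (by rw [← hm] at hn ho'; exact ⟨hn, ho'⟩))
      · exact Or.inr (Or.inr (by rw [← hn] at hm ho; exact ⟨hm, ho⟩))
      · exact Or.inl (hm.trans hn.symm)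
    rcases hcases with e | ⟨e, ho⟩ | ⟨e, ho⟩
    · obtain ⟨k, hk, t, ht⟩ := exists_coprime_dvd_sub hN (dvd_mul_left b.den a.den)
        (e ▸ a.isCoprime_num_den) b.isCoprime_num_den
      refine ⟨k, 2 * t, hk, mul_left_cancel₀ hdb ?_⟩
      have ht' : (b.num : ℚ) - k * a.num = b.den * t := by exact_mod_cast ht
      rw [e] at hma
      push_cast
      linear_combination 2 * ht' + 2 * hmb - 2 * k * hma
    · obtain ⟨k, hk, t, ht⟩ := exists_coprime_dvd_sub hN (dvd_mul_right a.den b.den)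
        (h2 ho a.isCoprime_num_den)
        (b.isCoprime_num_den.of_isCoprime_of_dvd_right (by rw [e]; exact_mod_cast dvd_mul_left _ _))
      refine ⟨k, t, hk, mul_left_cancel₀ hda ?_⟩
      have ht' : (b.num : ℚ) - k * (2 * a.num) = a.den * t := by exact_mod_cast ht
      rw [e] at hmb
      push_cast at hmb
      linear_combination ht' + hmb - 2 * k * hma
    · obtain ⟨k, hk, t, ht⟩ := exists_coprime_dvd_sub hN (dvd_mul_left b.den a.den)
        (a.isCoprime_num_den.of_isCoprime_of_dvd_right (by rw [e]; exact_mod_cast dvd_mul_left _ _))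
        (h2 ho b.isCoprime_num_den)
      refine ⟨k, t, hk, mul_left_cancel₀ hdb ?_⟩
      have ht' : 2 * (b.num : ℚ) - k * a.num = b.den * t := by exact_mod_cast ht
      rw [e] at hma
      push_cast at hma
      linear_combination ht' + 2 * hmb - k * hma

/-- Proposition `prop:sine-ratio-irrat`: if `r₁ ≠ r₂` are rationals in `(0, 1/4]`,
then `sin(2πr₁)/sin(2πr₂)` is rational if and only if
`(r₁, r₂) = (1/4, 1/12)` or `(r₁, r₂) = (1/12, 1/4)`; for all other pairs the ratio
is irrational. -/
theorem sin_ratio_rational_iff (r₁ r₂ : ℚ)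
    (h₁ : r₁ ∈ Set.Ioc (0 : ℚ) (1 / 4)) (h₂ : r₂ ∈ Set.Ioc (0 : ℚ) (1 / 4))
    (hne : r₁ ≠ r₂) :
    (∃ s : ℚ, Real.sin (2 * Real.pi * (r₁ : ℝ)) / Real.sin (2 * Real.pi * (r₂ : ℝ))
        = (s : ℝ)) ↔
      (r₁ = 1 / 4 ∧ r₂ = 1 / 12) ∨ (r₁ = 1 / 12 ∧ r₂ = 1 / 4) := by
  have hsin (r : ℚ) : Real.sin (2 * Real.pi * r) = Real.cos (2 * Real.pi * (1 / 4 - r : ℚ)) := by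
    rw [← Real.cos_pi_div_two_sub]
    push_cast
    ring_nf
  have hpos := cos_two_pi_mul_pos (a := 1 / 4 - r₂) (by linarith [h₂.2]) (by linarith [h₂.1])
  constructor
  · rintro ⟨s, hs⟩
    rw [hsin, hsin, div_eq_iff hpos.ne'] at hs
    rcases cos_ratio_cases (by linarith [h₁.2]) (by linarith [h₁.1]) (by linarith [h₂.2])
      (by linarith [h₂.1]) (fun h ↦ hne (by linarith)) hs with ⟨h1, h2⟩ | ⟨h1, h2⟩
    · exact Or.inl ⟨by linarith, by linarith⟩
    · exact Or.inr ⟨by linarith, by linarith⟩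
  · have h4 : Real.sin (2 * Real.pi * (1 / 4 : ℚ)) = 1 := by
      rw [← Real.sin_pi_div_two]
      push_cast
      ring_nf
    have h12 : Real.sin (2 * Real.pi * (1 / 12 : ℚ)) = 1 / 2 := by
      rw [← Real.sin_pi_div_six]
      push_cast
      ring_nf
    rintro (⟨rfl, rfl⟩ | ⟨rfl, rfl⟩)
    · exact ⟨2, by rw [h4, h12]; norm_num⟩
    · exact ⟨1 / 2, by rw [h4, h12]; norm_num⟩
end

section
/- Let p₁, q₁, p₂, q₂ be positive integers with gcd(p₁, q₁) = 1, gcd(p₂, q₂) = 1, 2p₁ ≤ q₁, 2p₂ ≤ q₂, and (p₁, q₁) ≠ (p₂, q₂). Then 2·q₁·sin(p₁π/q₁) ≠ 2·q₂·sin(p₂π/q₂). Equivalently, two periodic basic broken rays in the Euclidean unit disc that are not rotations of each other have different lengths. -/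
open IntermediateField in
theorem Algebra.exists_norm_eq_coeff_zero_minpoly_pow (F : Type*) {L : Type*} [Field F] [Field L]
    [Algebra F L] [FiniteDimensional F L] (x : L) :
    ∃ d : ℕ, 0 < d ∧ d ≤ Module.finrank F L ∧
      Algebra.norm F x = ((-1) ^ (minpoly F x).natDegree * (minpoly F x).coeff 0) ^ d := by
  have hint : IsIntegral F x := Algebra.IsIntegral.isIntegral x
  refine ⟨Module.finrank F⟮x⟯ L, Module.finrank_pos, ?_, ?_⟩
  · rw [← Module.finrank_mul_finrank F F⟮x⟯ L]
    exact Nat.le_mul_of_pos_left _ Module.finrank_pos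
  · have hgen := Algebra.PowerBasis.norm_gen_eq_coeff_zero_minpoly
      (IntermediateField.adjoin.powerBasis hint)
    rw [IntermediateField.adjoin.powerBasis_gen, IntermediateField.minpoly_gen,
      IntermediateField.adjoin.powerBasis_dim] at hgen
    rw [Algebra.norm_eq_norm_adjoin F x, hgen]

open Polynomial in
/-- The absolute norm of `ζ - 1` is a power of `|Φ_q(1)|`, with exponent at most the degree. -/
theorem IsPrimitiveRoot.exists_abs_norm_sub_one_eq {K : Type*} [Field K] [NumberField K]
    {ζ : K} {q : ℕ} (hζ : IsPrimitiveRoot ζ q) (hq : 0 < q) :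
    ∃ d : ℕ, 0 < d ∧ d ≤ Module.finrank ℚ K ∧
      |Algebra.norm ℚ (ζ - 1)| = |(cyclotomic q ℚ).eval 1| ^ d := by
  obtain ⟨d, hd, hle, hnorm⟩ := Algebra.exists_norm_eq_coeff_zero_minpoly_pow ℚ (ζ - 1)
  refine ⟨d, hd, hle, ?_⟩
  have hmin : minpoly ℚ (ζ - 1) = (cyclotomic q ℚ).comp (X + C 1) := by
    rw [cyclotomic_eq_minpoly_rat hζ hq, ← minpoly.sub_algebraMap, map_one]
  rw [hnorm, hmin, coeff_zero_eq_eval_zero, abs_pow, abs_mul, abs_pow]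
  simp

theorem IsPrimitiveRoot.abs_norm_eq_one {K : Type*} [Field K] [NumberField K]
    {ζ : K} {q : ℕ} (hζ : IsPrimitiveRoot ζ q) (hq : 0 < q) :
    |Algebra.norm ℚ ζ| = 1 := by
  have h : |Algebra.norm ℚ ζ| ^ q = 1 := by
    rw [← abs_pow, ← map_pow, hζ.pow_eq_one, map_one, abs_one]
  exact (pow_eq_one_iff_of_nonneg (abs_nonneg _) hq.ne').mp h

open Polynomial in
/-- Either `q` is a power of a prime `l = |Φ_q(1)|`, or `q` is no prime power and `Φ_q(1) = 1`. -/
theorem abs_eval_one_cyclotomic_cases {q : ℕ} (hq : 1 < q) :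
    (∃ l k : ℕ, l.Prime ∧ 0 < k ∧ q = l ^ k ∧ |(cyclotomic q ℚ).eval 1| = l) ∨
      (¬ IsPrimePow q ∧ |(cyclotomic q ℚ).eval 1| = 1) := by
  by_cases h : IsPrimePow q
  · obtain ⟨l, k, hl, hk, rfl⟩ := (isPrimePow_nat_iff q).mp h
    refine Or.inl ⟨l, k, hl, hk, rfl, ?_⟩
    obtain ⟨m, rfl⟩ := Nat.exists_eq_succ_of_ne_zero hk.ne'
    have := Fact.mk hl
    rw [Nat.succ_eq_add_one, eval_one_cyclotomic_prime_pow, Nat.abs_cast]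
  · refine Or.inr ⟨h, ?_⟩
    rw [eval_one_cyclotomic_not_prime_pow, abs_one]
    rintro l hl k rfl
    rcases Nat.eq_zero_or_pos k with rfl | hk
    · simp at hq
    · exact h ((isPrimePow_nat_iff _).mpr ⟨l, k, hl, hk, rfl⟩)

open Polynomial in
theorem eq_of_pow_mul_cyclotomic_eq {q₁ q₂ n d₁ d₂ : ℕ} (hq₁ : 1 < q₁) (hq₂ : 1 < q₂)
    (hd₁ : 0 < d₁) (hd₂ : 0 < d₂) (hn₁ : d₁ ≤ n) (hn₂ : d₂ ≤ n)
    (h : (q₁ : ℚ) ^ n * |(cyclotomic q₁ ℚ).eval 1| ^ d₁ =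
      (q₂ : ℚ) ^ n * |(cyclotomic q₂ ℚ).eval 1| ^ d₂) : q₁ = q₂ := by
  have hn : n ≠ 0 := by omega
  rcases abs_eval_one_cyclotomic_cases hq₁ with ⟨l, k, hl, hk, rfl, h₁⟩ | ⟨hp₁, h₁⟩ <;>
  rcases abs_eval_one_cyclotomic_cases hq₂ with ⟨m, j, hm, hj, rfl, h₂⟩ | ⟨hp₂, h₂⟩ <;>
  rw [h₁, h₂] at h
  · norm_cast at h
    simp only [← pow_mul, ← pow_add] at h
    obtain rfl : l = m := (Nat.prime_dvd_prime_iff_eq hl hm).mp <|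
      hl.dvd_of_dvd_pow (h ▸ dvd_pow_self l (by omega))
    have he : k * n + d₁ = j * n + d₂ := Nat.pow_right_injective hl.two_le h
    obtain rfl : k = j := by
      rcases lt_trichotomy k j with hkj | hkj | hkj
      · nlinarith [Nat.mul_le_mul_right n (Nat.succ_le_of_lt hkj)]
      · exact hkj
      · nlinarith [Nat.mul_le_mul_right n (Nat.succ_le_of_lt hkj)]
    rfl
  · norm_cast at h
    rw [one_pow, mul_one, ← pow_mul, ← pow_add] at h
    exact absurd ((isPrimePow_pow_iff hn).mp (h ▸ hl.isPrimePow.pow (by omega))) hp₂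
  · norm_cast at h
    rw [one_pow, mul_one, ← pow_mul, ← pow_add] at h
    exact absurd ((isPrimePow_pow_iff hn).mp (h ▸ hm.isPrimePow.pow (by omega))) hp₁
  · norm_cast at h
    rw [one_pow, one_pow, mul_one, mul_one] at h
    exact Nat.pow_left_injective hn h

theorem IsPrimitiveRoot.eq_of_sq_mul_sub_one_sq_eq {K : Type*} [Field K] [NumberField K]
    {ζ₁ ζ₂ : K} {q₁ q₂ : ℕ} (hζ₁ : IsPrimitiveRoot ζ₁ q₁) (hζ₂ : IsPrimitiveRoot ζ₂ q₂)
    (hq₁ : 1 < q₁) (hq₂ : 1 < q₂)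
    (h : (q₁ : K) ^ 2 * (ζ₁ - 1) ^ 2 * ζ₂ = (q₂ : K) ^ 2 * (ζ₂ - 1) ^ 2 * ζ₁) : q₁ = q₂ := by
  obtain ⟨d₁, hd₁, hn₁, h₁⟩ := hζ₁.exists_abs_norm_sub_one_eq (by omega)
  obtain ⟨d₂, hd₂, hn₂, h₂⟩ := hζ₂.exists_abs_norm_sub_one_eq (by omega)
  refine eq_of_pow_mul_cyclotomic_eq hq₁ hq₂ hd₁ hd₂ hn₁ hn₂ ?_
  have hnorm (q : ℕ) : |Algebra.norm ℚ (q : K)| = (q : ℚ) ^ Module.finrank ℚ K := by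
    rw [← map_natCast (algebraMap ℚ K), Algebra.norm_algebraMap, abs_pow, Nat.abs_cast]
  have h' := congrArg (fun x => |Algebra.norm ℚ x|) h
  simp only [map_mul, map_pow, abs_mul, abs_pow, hnorm, hζ₁.abs_norm_eq_one (by omega),
    hζ₂.abs_norm_eq_one (by omega), mul_one, ← mul_pow, h₁, h₂] at h'
  exact (pow_left_inj₀ (by positivity) (by positivity) two_ne_zero).mp h'

theorem Complex.exp_two_mul_I_sub_one_sq (θ : ℂ) :
    (exp (2 * (θ * I)) - 1) ^ 2 = -4 * sin θ ^ 2 * exp (2 * (θ * I)) := by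
  have he : exp (-θ * I) * exp (θ * I) = 1 := by rw [← exp_add]; simp
  have h2 : exp (2 * (θ * I)) = exp (θ * I) ^ 2 := by rw [← exp_nat_mul]; norm_num
  have hs : 2 * sin θ * exp (θ * I) = (1 - exp (θ * I) ^ 2) * I := by
    rw [two_sin, mul_right_comm, sub_mul, he, sq]
  rw [h2]
  linear_combination (2 * sin θ * exp (θ * I) + (1 - exp (θ * I) ^ 2) * I) * hs
    + (1 - exp (θ * I) ^ 2) ^ 2 * I_sq

/-- Theorem `thm:disc-lsp-example` (main claim): two periodic basic broken rays in the
Euclidean unit disc which are not rotations of each other, determined by distinct reduced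
fractions `p₁/q₁ ≠ p₂/q₂` in `(0, 1/2]`, have different lengths `2q·sin(pπ/q)`. -/
theorem disc_basic_lengths_distinct (p₁ q₁ p₂ q₂ : ℕ)
    (hp₁ : 0 < p₁) (hq₁ : 0 < q₁) (hp₂ : 0 < p₂) (hq₂ : 0 < q₂)
    (hco₁ : Nat.Coprime p₁ q₁) (hco₂ : Nat.Coprime p₂ q₂)
    (hle₁ : 2 * p₁ ≤ q₁) (hle₂ : 2 * p₂ ≤ q₂)
    (hne : (p₁, q₁) ≠ (p₂, q₂)) :
    2 * (q₁ : ℝ) * Real.sin ((p₁ : ℝ) * Real.pi / (q₁ : ℝ)) ≠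
      2 * (q₂ : ℝ) * Real.sin ((p₂ : ℝ) * Real.pi / (q₂ : ℝ)) := by
  intro h
  have hq : q₁ = q₂ := by
    set θ₁ : ℝ := (p₁ : ℝ) * Real.pi / (q₁ : ℝ) with hθ₁
    set θ₂ : ℝ := (p₂ : ℝ) * Real.pi / (q₂ : ℝ) with hθ₂
    set z₁ : ℂ := Complex.exp (2 * (θ₁ * Complex.I)) with hz₁
    set z₂ : ℂ := Complex.exp (2 * (θ₂ * Complex.I)) with hz₂
    have hprim₁ : IsPrimitiveRoot z₁ q₁ := by
      convert Complex.isPrimitiveRoot_exp_of_coprime p₁ q₁ hq₁.ne' hco₁ using 2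
      rw [hθ₁]; push_cast; ring
    have hprim₂ : IsPrimitiveRoot z₂ q₂ := by
      convert Complex.isPrimitiveRoot_exp_of_coprime p₂ q₂ hq₂.ne' hco₂ using 2
      rw [hθ₂]; push_cast; ring
    have hC : (q₁ : ℂ) * Complex.sin θ₁ = q₂ * Complex.sin θ₂ := by
      have : (q₁ : ℝ) * Real.sin θ₁ = q₂ * Real.sin θ₂ := by linarith
      exact_mod_cast this
    have key : (q₁ : ℂ) ^ 2 * (z₁ - 1) ^ 2 * z₂ = (q₂ : ℂ) ^ 2 * (z₂ - 1) ^ 2 * z₁ := by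
      rw [hz₁, hz₂, Complex.exp_two_mul_I_sub_one_sq, Complex.exp_two_mul_I_sub_one_sq,
        ← hz₁, ← hz₂]
      linear_combination
        (-4 * z₁ * z₂ * (q₁ * Complex.sin θ₁ + q₂ * Complex.sin θ₂)) * hC
    let K := IntermediateField.adjoin ℚ ({z₁, z₂} : Set ℂ)
    have : FiniteDimensional ℚ K := by
      refine IntermediateField.finiteDimensional_adjoin ?_
      rintro x (rfl | rfl)
      · exact (hprim₁.isIntegral hq₁).tower_top
      · exact (hprim₂.isIntegral hq₂).tower_top
    have : NumberField K := ⟨⟩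
    let w₁ : K := ⟨z₁, IntermediateField.subset_adjoin ℚ _ (by simp)⟩
    let w₂ : K := ⟨z₂, IntermediateField.subset_adjoin ℚ _ (by simp)⟩
    have hw₁ : IsPrimitiveRoot w₁ q₁ := IsPrimitiveRoot.coe_submonoidClass_iff.mp hprim₁
    have hw₂ : IsPrimitiveRoot w₂ q₂ := IsPrimitiveRoot.coe_submonoidClass_iff.mp hprim₂
    exact hw₁.eq_of_sq_mul_sub_one_sq_eq hw₂ (by omega) (by omega) (Subtype.ext key)
  subst hq
  have hq0 : (0 : ℝ) < q₁ := by exact_mod_cast hq₁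
  have hmem {p : ℕ} (hp : 2 * p ≤ q₁) :
      (p : ℝ) * Real.pi / q₁ ∈ Set.Icc (-(Real.pi / 2)) (Real.pi / 2) := by
    have hp' : 2 * (p : ℝ) ≤ q₁ := by exact_mod_cast hp
    constructor
    · have : 0 ≤ (p : ℝ) * Real.pi / q₁ := by positivity
      linarith [Real.pi_pos]
    · rw [div_le_div_iff₀ hq0 two_pos]
      nlinarith [Real.pi_pos]
  have hang := Real.injOn_sin (hmem hle₁) (hmem hle₂)
    (mul_left_cancel₀ (by positivity) h)
  rw [div_left_inj' hq0.ne', mul_left_inj' Real.pi_ne_zero, Nat.cast_inj] at hang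
  exact hne (by rw [hang])
end

section
/- Let p₁, q₁, p₂, q₂ be positive integers with gcd(p₁, q₁) = 1, gcd(p₂, q₂) = 1, 2p₁ ≤ q₁, 2p₂ ≤ q₂, and (p₁, q₁) ≠ (p₂, q₂). Then the ratio (q₁·sin(p₁π/q₁))/(q₂·sin(p₂π/q₂)) is rational if and only if {(p₁,q₁), (p₂,q₂)} = {(1,6), (1,2)}, i.e. one ray is the regular hexagon (length 6) and the other the diameter counted back and forth (length 4). -/
open Polynomial

theorem squarefree_eval_one_cyclotomic {n : ℕ} (hn : 2 ≤ n) :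
    ∃ N : ℕ, Squarefree N ∧ ∀ (R : Type) [CommRing R], eval 1 (cyclotomic n R) = N := by
  by_cases h : ∃ p k : ℕ, p.Prime ∧ p ^ k = n
  · obtain ⟨p, k, hp, rfl⟩ := h
    have := Fact.mk hp
    obtain _ | k := k
    · simp at hn
    · exact ⟨p, hp.squarefree, fun R _ => eval_one_cyclotomic_prime_pow k⟩
  · refine ⟨1, squarefree_one, fun R _ => ?_⟩
    rw [eval_one_cyclotomic_not_prime_pow fun {p} hp k hk => h ⟨p, k, hp, hk⟩, Nat.cast_one]

theorem IsPrimitiveRoot.associated_sub_one_pow_eval_one_cyclotomic {R : Type*} [CommRing R]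
    [IsDomain R] {ζ : R} {n : ℕ} (hn : 0 < n) (hζ : IsPrimitiveRoot ζ n) :
    Associated ((ζ - 1) ^ n.totient) (eval 1 (cyclotomic n R)) := by
  rw [cyclotomic_eq_prod_X_sub_primitiveRoots hζ, eval_prod, ← hζ.card_primitiveRoots,
    ← Finset.prod_const]
  refine Associated.prod _ _ _ fun μ hμ => ?_
  have := NeZero.mk hn.ne'
  obtain ⟨i, -, hi, rfl⟩ := hζ.isPrimitiveRoot_iff.mp ((mem_primitiveRoots hn).mp hμ)
  simpa using (hζ.associated_sub_one_pow_sub_one_of_coprime hi).neg_right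

theorem natCast_dvd_natCast_integralClosure {k l : ℕ}
    (h : (k : integralClosure ℤ ℂ) ∣ l) : k ∣ l := by
  obtain ⟨c, hc⟩ := h
  replace hc : (l : ℂ) = k * (c : ℂ) := by exact_mod_cast congrArg Subtype.val hc
  obtain rfl | hk := eq_or_ne k 0
  · simpa using hc
  have hk' : (k : ℂ) ≠ 0 := by exact_mod_cast hk
  have hq : algebraMap ℚ ℂ (l / k : ℚ) = c := by
    simp [hc, hk']
  have hint : IsIntegral ℤ (l / k : ℚ) := by
    have := c.2
    rw [mem_integralClosure_iff, ← hq] at this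
    exact (isIntegral_algebraMap_iff (algebraMap ℚ ℂ).injective).mp this
  obtain ⟨z, hz⟩ := IsIntegrallyClosed.isIntegral_iff.mp hint
  have hkq : (k : ℚ) ≠ 0 := by exact_mod_cast hk
  rw [eq_div_iff hkq, eq_intCast] at hz
  refine Int.natCast_dvd_natCast.mp ⟨z, ?_⟩
  rw [mul_comm]
  exact_mod_cast hz.symm

theorem natCast_associated_natCast_integralClosure {k l : ℕ}
    (h : Associated (k : integralClosure ℤ ℂ) l) : k = l :=
  Nat.dvd_antisymm (natCast_dvd_natCast_integralClosure h.dvd)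
    (natCast_dvd_natCast_integralClosure h.symm.dvd)

theorem associated_two_mul_sin {p q : ℕ} (hco : p.Coprime q) (hq : 2 ≤ q) :
    ∃ (X : integralClosure ℤ ℂ) (N : ℕ),
      (X : ℂ) = ((2 * Real.sin (p * Real.pi / q) : ℝ) : ℂ) ∧ Squarefree N ∧
        Associated (X ^ q.totient) N := by
  obtain ⟨N, hN, hcyc⟩ := squarefree_eval_one_cyclotomic hq
  have hq0 : q ≠ 0 := by omega
  have hq' : (q : ℂ) ≠ 0 := by exact_mod_cast hq0
  set z : ℂ := Complex.exp (2 * Real.pi * Complex.I * (p / q)) with hz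
  have hzprim : IsPrimitiveRoot z q := Complex.isPrimitiveRoot_exp_of_coprime p q hq0 hco
  have hzint : IsIntegral ℤ z := hzprim.isIntegral (by omega)
  set w : ℂ := Complex.exp (-(p * Real.pi / q) * Complex.I) * -Complex.I with hw
  have hwpow : w ^ (4 * q) = 1 := by
    rw [hw, mul_pow, ← Complex.exp_nat_mul, pow_mul (-Complex.I), neg_pow, Complex.I_pow_four]
    have : ((4 * q : ℕ) : ℂ) * (-(p * Real.pi / q) * Complex.I)
        = (-(2 * p) : ℤ) * (2 * Real.pi * Complex.I) := by
      push_cast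
      field_simp
      ring
    rw [this, Complex.exp_int_mul_two_pi_mul_I]
    norm_num
  have hwint : IsIntegral ℤ w := IsIntegral.of_pow (n := 4 * q) (by omega)
    (hwpow ▸ isIntegral_one)
  have hX : (z - 1) * w = ((2 * Real.sin (p * Real.pi / q) : ℝ) : ℂ) := by
    push_cast
    rw [Complex.sin, hz, hw]
    have h1 : (2 * Real.pi * Complex.I * (p / q) : ℂ) =
      p * Real.pi / q * Complex.I + p * Real.pi / q * Complex.I := by ring
    rw [h1, Complex.exp_add, neg_mul, Complex.exp_neg]
    field_simp [Complex.exp_ne_zero]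
    ring
  let Z : integralClosure ℤ ℂ := ⟨z, hzint⟩
  let W : integralClosure ℤ ℂ := ⟨w, hwint⟩
  have hZ : IsPrimitiveRoot Z q :=
    IsPrimitiveRoot.of_map_of_injective (f := (integralClosure ℤ ℂ).val) hzprim
      Subtype.val_injective
  have hW : IsUnit W := IsUnit.of_pow_eq_one (n := 4 * q) (Subtype.ext hwpow) (by omega)
  refine ⟨(Z - 1) * W, N, hX, hN, ?_⟩
  rw [← hcyc]
  refine Associated.trans (Associated.pow_pow ?_)
    (hZ.associated_sub_one_pow_eval_one_cyclotomic (by omega))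
  exact associated_mul_unit_left _ _ hW

theorem nat_pow_mul_eq_of_associated {X Y : integralClosure ℤ ℂ} {M N a b m n : ℕ}
    (hX : Associated (X ^ a) M) (hY : Associated (Y ^ b) N) (h : X * n = m * Y) :
    M ^ b * n ^ (a * b) = m ^ (a * b) * N ^ a := by
  apply natCast_associated_natCast_integralClosure
  push_cast
  have h1 := (hX.pow_pow (n := b)).mul_right ((n : integralClosure ℤ ℂ) ^ (a * b))
  have h2 := (hY.pow_pow (n := a)).mul_left ((m : integralClosure ℤ ℂ) ^ (a * b))
  rw [← pow_mul, ← mul_pow, h] at h1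
  rw [← pow_mul, mul_comm b a, ← mul_pow] at h2
  exact h1.symm.trans h2

theorem eq_of_mul_add_mul_eq {a b u v x y : ℕ} (ha : 2 ≤ a ∨ u = 0) (ha0 : 0 < a) (hb : 2 ≤ b)
    (hu : u ≤ 1) (hv : v ≤ 1) (h : b * u + a * b * x = a * b * y + a * v) : x = y := by
  have hab : 0 < a * b := by positivity
  have hbu : a ∣ b * u :=
    (Nat.dvd_add_left (c := a * b * x) ⟨b * x, by ring⟩).mp (h ▸ ⟨b * y + v, by ring⟩)
  have hav : b ∣ a * v :=
    (Nat.dvd_add_right (b := a * b * y) ⟨a * y, by ring⟩).mp (h ▸ ⟨u + a * x, by ring⟩)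
  suffices b * u = a * v from Nat.eq_of_mul_eq_mul_left hab (by omega)
  interval_cases u <;> interval_cases v
  · simp
  · have h' : b * x = b * y + 1 := Nat.eq_of_mul_eq_mul_left ha0 (by linarith)
    have : b ∣ 1 := (Nat.dvd_add_right (dvd_mul_right b y)).mp (h' ▸ dvd_mul_right b x)
    have := Nat.le_of_dvd one_pos this
    omega
  · have h' : a * x + 1 = a * y :=
      Nat.eq_of_mul_eq_mul_left (show 0 < b by omega) (by linarith)
    have : a ∣ 1 := (Nat.dvd_add_right (dvd_mul_right a x)).mp (h' ▸ dvd_mul_right a y)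
    have := Nat.le_of_dvd one_pos this
    omega
  · rw [mul_one] at hbu hav ⊢
    rw [mul_one]
    exact Nat.dvd_antisymm hav hbu

theorem eq_of_squarefree_pow_mul_pow_eq {M N a b m n : ℕ} (hM : Squarefree M) (hN : Squarefree N)
    (ha : 2 ≤ a ∨ M = 1) (ha0 : 0 < a) (hb : 2 ≤ b) (hm : m ≠ 0) (hn : n ≠ 0)
    (h : M ^ b * n ^ (a * b) = m ^ (a * b) * N ^ a) : n = m := by
  refine Nat.eq_of_factorization_eq hn hm fun l => ?_
  have hfac := congrArg (fun k => k.factorization l) h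
  simp only [Nat.factorization_mul (pow_ne_zero _ hM.ne_zero) (pow_ne_zero _ hn),
    Nat.factorization_mul (pow_ne_zero _ hm) (pow_ne_zero _ hN.ne_zero), Nat.factorization_pow,
    Finsupp.add_apply, Finsupp.smul_apply, smul_eq_mul] at hfac
  exact eq_of_mul_add_mul_eq (ha.imp_right fun h1 => by simp [h1]) ha0 hb
    (hM.natFactorization_le_one l) (hN.natFactorization_le_one l) hfac

theorem two_le_totient {q : ℕ} (hq : 3 ≤ q) : 2 ≤ q.totient := by
  have h0 : 0 < q.totient := Nat.totient_pos.mpr (by omega)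
  have h1 : q.totient ≠ 1 := fun h => by
    have := Nat.totient_eq_one_iff.mp h
    omega
  omega

theorem eq_of_mul_eq_mul_two_sin {X : integralClosure ℤ ℂ} {M a m n p q : ℕ}
    (hX : Associated (X ^ a) M) (hM : Squarefree M) (ha : 2 ≤ a ∨ M = 1) (ha0 : 0 < a)
    (hm : m ≠ 0) (hn : n ≠ 0) (hco : p.Coprime q) (hq : 3 ≤ q)
    (h : (X : ℂ) * n = m * ((2 * Real.sin (p * Real.pi / q) : ℝ) : ℂ)) : n = m := by
  obtain ⟨Y, N, hY, hN, hYN⟩ := associated_two_mul_sin hco (by omega)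
  rw [← hY] at h
  exact eq_of_squarefree_pow_mul_pow_eq hM hN ha ha0 (two_le_totient hq) hm hn
    (nat_pow_mul_eq_of_associated hX hYN (Subtype.ext (by push_cast; exact h)))

theorem eq_of_sin_mul_eq_mul_sin {p₁ q₁ p₂ q₂ m n : ℕ} (hco₁ : p₁.Coprime q₁)
    (hco₂ : p₂.Coprime q₂) (hq₁ : 3 ≤ q₁) (hq₂ : 3 ≤ q₂) (hm : m ≠ 0) (hn : n ≠ 0)
    (h : Real.sin (p₁ * Real.pi / q₁) * n = m * Real.sin (p₂ * Real.pi / q₂)) : n = m := by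
  obtain ⟨X, M, hX, hM, hXM⟩ := associated_two_mul_sin hco₁ (by omega)
  have hφ := two_le_totient hq₁
  refine eq_of_mul_eq_mul_two_sin hXM hM (Or.inl hφ) (by omega) hm hn hco₂ hq₂ ?_
  rw [hX]
  norm_cast
  linear_combination 2 * h

theorem sin_eq_half_of_natCast_eq_mul_sin {p q m n : ℕ} (hco : p.Coprime q) (hq : 3 ≤ q)
    (hm : m ≠ 0) (hn : n ≠ 0) (h : (n : ℝ) = m * Real.sin (p * Real.pi / q)) :
    Real.sin (p * Real.pi / q) = 1 / 2 := by
  have h2 : 2 * n = m := by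
    refine eq_of_mul_eq_mul_two_sin (X := 1) (M := 1) (a := 1) (by simp) squarefree_one
      (Or.inr rfl) one_pos hm (by omega) hco hq ?_
    rw [OneMemClass.coe_one, one_mul]
    norm_cast
    push_cast
    linear_combination 2 * h
  have hn' : (n : ℝ) ≠ 0 := by exact_mod_cast hn
  rw [← h2] at h
  push_cast at h
  apply mul_left_cancel₀ hn'
  linear_combination -(1 / 2) * h

theorem prod_eq_of_sin_eq {p₁ q₁ p₂ q₂ : ℕ} (hq₁ : 0 < q₁) (hq₂ : 0 < q₂)
    (hco₁ : p₁.Coprime q₁) (hco₂ : p₂.Coprime q₂) (hle₁ : 2 * p₁ ≤ q₁) (hle₂ : 2 * p₂ ≤ q₂)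
    (h : Real.sin (p₁ * Real.pi / q₁) = Real.sin (p₂ * Real.pi / q₂)) :
    (p₁, q₁) = (p₂, q₂) := by
  have hmem {p q : ℕ} (hq : 0 < q) (hle : 2 * p ≤ q) :
      (p * Real.pi / q : ℝ) ∈ Set.Icc (-(Real.pi / 2)) (Real.pi / 2) := by
    have hq' : (0 : ℝ) < q := by exact_mod_cast hq
    have hle' : 2 * (p : ℝ) ≤ q := by exact_mod_cast hle
    refine ⟨le_trans (by linarith [Real.pi_pos]) (show 0 ≤ (p * Real.pi / q : ℝ) by positivity), ?_⟩
    rw [div_le_div_iff₀ hq' two_pos]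
    nlinarith [Real.pi_pos]
  have heq := Real.injOn_sin (hmem hq₁ hle₁) (hmem hq₂ hle₂) h
  have hq₁' : (q₁ : ℝ) ≠ 0 := by positivity
  have hq₂' : (q₂ : ℝ) ≠ 0 := by positivity
  rw [div_eq_div_iff hq₁' hq₂'] at heq
  have hcross : p₁ * q₂ = p₂ * q₁ := by
    have : (p₁ : ℝ) * q₂ = p₂ * q₁ := mul_left_cancel₀ Real.pi_ne_zero (by linear_combination heq)
    exact_mod_cast this
  have hp : p₁ = p₂ := Nat.dvd_antisymm
    (hco₁.dvd_of_dvd_mul_right (hcross ▸ dvd_mul_right p₁ q₂))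
    (hco₂.dvd_of_dvd_mul_right (hcross ▸ dvd_mul_right p₂ q₁))
  have hq : q₁ = q₂ := Nat.dvd_antisymm
    (hco₁.symm.dvd_of_dvd_mul_left (hcross ▸ dvd_mul_left q₁ p₂))
    (hco₂.symm.dvd_of_dvd_mul_left (hcross ▸ dvd_mul_left q₂ p₁))
  rw [hp, hq]

theorem prod_eq_one_six_of_sin_eq_half {p q : ℕ} (hq : 0 < q) (hco : p.Coprime q)
    (hle : 2 * p ≤ q) (h : Real.sin (p * Real.pi / q) = 1 / 2) : (p, q) = (1, 6) :=
  prod_eq_of_sin_eq hq (by norm_num) hco (by norm_num) hle (by norm_num)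
    (by rw [h]; norm_num [Real.sin_pi_div_six])

theorem sin_natCast_mul_pi_div_pos {p q : ℕ} (hp : 0 < p) (hle : 2 * p ≤ q) :
    0 < Real.sin (p * Real.pi / q) := by
  have hp' : (0 : ℝ) < p := by exact_mod_cast hp
  have hle' : 2 * (p : ℝ) ≤ q := by exact_mod_cast hle
  have hq' : (0 : ℝ) < q := by linarith
  refine Real.sin_pos_of_pos_of_lt_pi (by positivity) ?_
  rw [div_lt_iff₀ hq']
  nlinarith [Real.pi_pos]

/-- Theorem `thm:disc-lsp-example` (rationality characterization): for two distinct
periodic basic broken rays in the Euclidean unit disc, given by distinct reduced fractions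
`p₁/q₁ ≠ p₂/q₂` in `(0, 1/2]`, the ratio of their lengths `(q₁·sin(p₁π/q₁))/(q₂·sin(p₂π/q₂))`
is rational if and only if one ray is the regular hexagon `(1,6)` and the other the diameter
`(1,2)`. -/
theorem disc_basic_length_ratio_rational_iff (p₁ q₁ p₂ q₂ : ℕ)
    (hp₁ : 0 < p₁) (hq₁ : 0 < q₁) (hp₂ : 0 < p₂) (hq₂ : 0 < q₂)
    (hco₁ : Nat.Coprime p₁ q₁) (hco₂ : Nat.Coprime p₂ q₂)
    (hle₁ : 2 * p₁ ≤ q₁) (hle₂ : 2 * p₂ ≤ q₂)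
    (hne : (p₁, q₁) ≠ (p₂, q₂)) :
    (∃ s : ℚ, ((q₁ : ℝ) * Real.sin ((p₁ : ℝ) * Real.pi / (q₁ : ℝ))) /
        ((q₂ : ℝ) * Real.sin ((p₂ : ℝ) * Real.pi / (q₂ : ℝ))) = (s : ℝ)) ↔
      ((p₁, q₁) = (1, 6) ∧ (p₂, q₂) = (1, 2)) ∨
        ((p₁, q₁) = (1, 2) ∧ (p₂, q₂) = (1, 6)) := by
  constructor
  · rintro ⟨s, hs⟩
    have hsin₁ := sin_natCast_mul_pi_div_pos hp₁ hle₁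
    have hsin₂ := sin_natCast_mul_pi_div_pos hp₂ hle₂
    have hq₁' : (0 : ℝ) < q₁ := by exact_mod_cast hq₁
    have hq₂' : (0 : ℝ) < q₂ := by exact_mod_cast hq₂
    have hspos : 0 < s := by
      have : (0 : ℝ) < s := hs ▸ by positivity
      exact_mod_cast this
    obtain ⟨k, hk⟩ := Int.eq_ofNat_of_zero_le (Rat.num_pos.mpr hspos).le
    have hk0 : k ≠ 0 := by
      have := Rat.num_pos.mpr hspos
      omega
    have hsk : (s : ℝ) = k / s.den := by
      rw [Rat.cast_def, hk, Int.cast_natCast]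
    have hden : (s.den : ℝ) ≠ 0 := by exact_mod_cast s.den_ne_zero
    have hn : q₁ * s.den ≠ 0 := mul_ne_zero hq₁.ne' s.den_ne_zero
    have hm : k * q₂ ≠ 0 := mul_ne_zero hk0 hq₂.ne'
    have hlin : Real.sin (p₁ * Real.pi / q₁) * (q₁ * s.den : ℕ)
        = (k * q₂ : ℕ) * Real.sin (p₂ * Real.pi / q₂) := by
      rw [hsk, div_eq_div_iff (by positivity) hden] at hs
      push_cast
      linear_combination hs
    have sin_one {p q : ℕ} (hp : p = 1) (hq : q = 2) : Real.sin (p * Real.pi / q) = 1 := by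
      simp [hp, hq]
    obtain h₁ | h₁ : q₁ = 2 ∨ 3 ≤ q₁ := by omega
    · have hp₁1 : p₁ = 1 := by omega
      obtain h₂ | h₂ : q₂ = 2 ∨ 3 ≤ q₂ := by omega
      · exact absurd (Prod.ext (show p₁ = p₂ by omega) (h₁.trans h₂.symm)) hne
      · rw [sin_one hp₁1 h₁, one_mul] at hlin
        exact Or.inr ⟨Prod.ext hp₁1 h₁, prod_eq_one_six_of_sin_eq_half hq₂ hco₂ hle₂
          (sin_eq_half_of_natCast_eq_mul_sin hco₂ h₂ hm hn hlin)⟩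
    · obtain h₂ | h₂ : q₂ = 2 ∨ 3 ≤ q₂ := by omega
      · have hp₂1 : p₂ = 1 := by omega
        rw [sin_one hp₂1 h₂, mul_one, mul_comm] at hlin
        exact Or.inl ⟨prod_eq_one_six_of_sin_eq_half hq₁ hco₁ hle₁
          (sin_eq_half_of_natCast_eq_mul_sin hco₁ h₁ hn hm hlin.symm), Prod.ext hp₂1 h₂⟩
      · have hmn := eq_of_sin_mul_eq_mul_sin hco₁ hco₂ h₁ h₂ hm hn hlin
        rw [hmn, mul_comm] at hlin
        have hsin := mul_left_cancel₀ (Nat.cast_ne_zero.mpr hm) hlin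
        exact absurd (prod_eq_of_sin_eq hq₁ hq₂ hco₁ hco₂ hle₁ hle₂ hsin) hne
  · rintro (⟨h₁, h₂⟩ | ⟨h₁, h₂⟩) <;> obtain ⟨rfl, rfl⟩ := Prod.mk.inj h₁ <;>
      obtain ⟨rfl, rfl⟩ := Prod.mk.inj h₂
    · exact ⟨3 / 2, by norm_num⟩
    · exact ⟨2 / 3, by norm_num⟩
end

section
/- Let 0 < R < 1, let μ : [R,1] → ℝ be differentiable, ρ : [R,1] → ℝ continuous, k ∈ ℝ, and ω_n > 0. Let U : ℝ × [R,1] → ℝ be jointly continuous such that for every ω the function U(ω,·) is twice differentiable and satisfies (r²μ(r)∂_r U(ω,r))′ = (rμ′(r) + k²μ(r))U(ω,r) − ω²ρ(r)r²U(ω,r) on [R,1], with T(U(ω,·))(R) = 0 for every ω, where T(W)(r) = μ(r)(W′(r) − W(r)/r). Set U_n = U(ω_n,·) and suppose U_n also satisfies T(U_n)(1) = 0 (Neumann conditions at both endpoints). Define D(ω) = U_n(1)·T(U(ω,·))(1) and assume D is differentiable at ω_n. Then ∫_R^1 ρ(r) r² U_n(r)² dr = − D′(ω_n)/(2ω_n).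 -/
open MeasureTheory intervalIntegral

/-- The traction `T(W)(r) = μ(r)·(W′(r) − W(r)/r)`. -/
noncomputable def traction (μ W : ℝ → ℝ) (r : ℝ) : ℝ := μ r * (deriv W r - W r / r)

/-- A product of `x - a` with a function continuous at `a` has derivative `g a` at `a`. -/
theorem hasDerivAt_sub_mul_of_continuousAt {g : ℝ → ℝ} {a : ℝ} (hg : ContinuousAt g a) :
    HasDerivAt (fun x => (x - a) * g x) (g a) a := by
  rw [hasDerivAt_iff_tendsto_slope]
  refine (hg.tendsto.mono_left nhdsWithin_le_nhds).congr' ?_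
  filter_upwards [self_mem_nhdsWithin] with x hx
  have hxa : x - a ≠ 0 := sub_ne_zero.mpr hx
  simp [slope_def_field, hxa]

/-- The eigenfunction normalization formula `∫_R^1 ρ r² U_n² dr = −(∂_ω D)(ω_n)/(2ω_n)`,
where `D(ω) = U_n(1)·T(U(ω,·))(1)`, for a jointly continuous family `U(ω, ·)` of solutions
of the toroidal radial equation satisfying the inner Neumann condition `T(U(ω,·))(R) = 0`
for every `ω`, with `U_n = U(ω_n, ·)` also satisfying the outer Neumann condition
`T(U_n)(1) = 0`. -/
theorem normalization_integral_eq_deriv_D (R : ℝ) (hR0 : 0 < R) (hR1 : R < 1)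
    (μ ρ : ℝ → ℝ) (k ωn : ℝ) (hωn : 0 < ωn) (U : ℝ → ℝ → ℝ)
    (hμ : ∀ r ∈ Set.Icc R 1, DifferentiableAt ℝ μ r)
    (hρ : ContinuousOn ρ (Set.Icc R 1))
    (hcont : Continuous (fun q : ℝ × ℝ => U q.1 q.2))
    (hU : ∀ ω : ℝ, ∀ r ∈ Set.Icc R 1, DifferentiableAt ℝ (U ω) r)
    (hU' : ∀ ω : ℝ, ∀ r ∈ Set.Icc R 1, DifferentiableAt ℝ (deriv (U ω)) r)
    (hODE : ∀ ω : ℝ, ∀ r ∈ Set.Icc R 1,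
      deriv (fun s => s ^ 2 * μ s * deriv (U ω) s) r
        = (r * deriv μ r + k ^ 2 * μ r) * U ω r - ω ^ 2 * ρ r * r ^ 2 * U ω r)
    (hinner : ∀ ω : ℝ, traction μ (U ω) R = 0)
    (houter : traction μ (U ωn) 1 = 0)
    (hD : DifferentiableAt ℝ (fun ω => U ωn 1 * traction μ (U ω) 1) ωn) :
    ∫ r in R..(1 : ℝ), ρ r * r ^ 2 * (U ωn r) ^ 2
      = - deriv (fun ω => U ωn 1 * traction μ (U ω) 1) ωn / (2 * ωn) := by
  obtain ⟨ρ', hρ'c, hρ'⟩ : ∃ ρ' : ℝ → ℝ, Continuous ρ' ∧ ∀ r ∈ Set.Icc R 1, ρ' r = ρ r :=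
    ⟨Set.IccExtend hR1.le ((Set.Icc R 1).domRestrict ρ),
      hρ.domRestrict.Icc_extend', fun r hr => by simp [Set.IccExtend_of_mem _ _ hr]⟩
  set J : ℝ → ℝ := fun ω => ∫ r in R..(1 : ℝ), ρ' r * r ^ 2 * (U ωn r * U ω r)
  have hUc : ∀ ω, Continuous (U ω) := fun ω => hcont.comp (by fun_prop : Continuous fun r => (ω, r))
  have hJc : Continuous J := by
    apply continuous_parametric_intervalIntegral_of_continuous'
    have h1 := hUc ωn
    exact ((hρ'c.comp continuous_snd).mul (continuous_snd.pow 2)).mul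
      ((h1.comp continuous_snd).mul hcont)
  have hDJ : ∀ ω, U ωn 1 * traction μ (U ω) 1 = (ω - ωn) * (-(ω + ωn) * J ω) := by
    intro ω
    have hderiv : ∀ r ∈ Set.uIcc R 1, HasDerivAt
        (fun s => U ωn s * (s ^ 2 * μ s * deriv (U ω) s)
          - U ω s * (s ^ 2 * μ s * deriv (U ωn) s))
        ((ωn ^ 2 - ω ^ 2) * (ρ' r * r ^ 2 * (U ωn r * U ω r))) r := by
      intro r hr
      rw [Set.uIcc_of_le hR1.le] at hr
      have hflux : ∀ ν, HasDerivAt (fun s => s ^ 2 * μ s * deriv (U ν) s)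
          ((r * deriv μ r + k ^ 2 * μ r) * U ν r - ν ^ 2 * ρ r * r ^ 2 * U ν r) r := by
        intro ν
        rw [← hODE ν r hr]
        exact (((differentiableAt_id.pow 2).mul (hμ r hr)).mul (hU' ν r hr)).hasDerivAt
      refine (((hU ωn r hr).hasDerivAt.mul (hflux ω)).sub
        ((hU ω r hr).hasDerivAt.mul (hflux ωn))).congr_deriv ?_
      rw [hρ' r hr]
      ring
    have hI := integral_eq_sub_of_hasDerivAt hderiv
      (Continuous.intervalIntegrable (by have := hUc ω; have := hUc ωn; fun_prop) _ _)
    rw [intervalIntegral.integral_const_mul] at hI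
    have h1 := hinner ω
    have h2 := hinner ωn
    have h3 := houter
    simp only [traction] at h1 h2 h3 ⊢
    change (ωn ^ 2 - ω ^ 2) * J ω = _ at hI
    linear_combination (-1 : ℝ) * hI + U ω 1 * h3 + U ωn R * R ^ 2 * h1 - U ω R * R ^ 2 * h2
  have hderivD : HasDerivAt (fun ω => U ωn 1 * traction μ (U ω) 1)
      (-(ωn + ωn) * J ωn) ωn := by
    rw [funext hDJ]
    exact hasDerivAt_sub_mul_of_continuousAt
      (g := fun ω => -(ω + ωn) * J ω) (by fun_prop : Continuous _).continuousAt
  have hint : ∫ r in R..(1 : ℝ), ρ r * r ^ 2 * (U ωn r) ^ 2 = J ωn := by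
    refine intervalIntegral.integral_congr fun r hr => ?_
    rw [Set.uIcc_of_le hR1.le] at hr
    simp only [hρ' r hr]
    ring
  rw [hint, hderivD.deriv]
  field_simp
  ring
end
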